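/- arXiv:2210.12123 — 2 statements merged into one kernel-verified Lean document; each statement's English description precedes it below -/
import Mathlib

section
/- Let τ > 0, let H ∈ ℂ be a scalar feedforward gain, and let s ∈ ℂ be such that sI_n − A, sI_N − A_N and sI_n − A + BK are invertible, 1 + K(sI_n − A)⁻¹B ≠ 0, and 1 + L_est^aug(s) ≠ 0, where L_est^aug(s) = P_N(s) C(sI_n − A)⁻¹L_1 + C_N(sI_N − A_N)⁻¹L_2; set F̄(s) = (1 + L_est^aug(s))⁻¹ and Δ(s) = e^{−sτ} − P_N(s). Suppose the complex scalars R, D, N, U, W̃ᵐ, Y satisfy: U = −K(sI_n − A + BK)⁻¹L_1 · W̃ᵐ + (1 + K(sI_n − A)⁻¹B)⁻¹ H R; W̃ᵐ = F̄(s)(Δ(s) G(s) U + e^{−sτ} G_d(s) D + N); and Y = C(sI_n − A)⁻¹(B U + E D). Then Y = C(sI_n − A + BK)⁻¹ B H R + G_d(s) D − C(sI_n − A)⁻¹ B K (sI_n − A + BK)⁻¹ L_1 · W̃ᵐ. -/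
open Matrix

noncomputable section

/-- Push-through identity: `(M + BK)⁻¹B(I + KM⁻¹B) = M⁻¹B`. -/
theorem inv_add_mul_mul_one_add {n m 𝕜 : Type*} [Fintype n] [DecidableEq n] [Fintype m]
    [DecidableEq m] [CommRing 𝕜] {M : Matrix n n 𝕜} (B : Matrix n m 𝕜) (K : Matrix m n 𝕜)
    (hM : IsUnit M) (hMBK : IsUnit (M + B * K)) :
    (M + B * K)⁻¹ * B * (1 + K * M⁻¹ * B) = M⁻¹ * B := by
  have hfactor : B * (1 + K * M⁻¹ * B) = (M + B * K) * (M⁻¹ * B) := by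
    rw [Matrix.add_mul, ← Matrix.mul_assoc M,
      Matrix.mul_nonsing_inv M ((Matrix.isUnit_iff_isUnit_det M).mp hM)]
    simp only [Matrix.mul_add, Matrix.mul_one, Matrix.one_mul, Matrix.mul_assoc]
  rw [Matrix.mul_assoc, hfactor, ← Matrix.mul_assoc,
    Matrix.nonsing_inv_mul _ ((Matrix.isUnit_iff_isUnit_det _).mp hMBK), Matrix.one_mul]

/-- Corollary 1 (output response), pointwise in `s`: given the defining relations for
`U`, `W̃ᵐ` and `Y`, the output satisfies
`Y = C(sI − A + BK)⁻¹BHR + G_d(s)D − C(sI − A)⁻¹BK(sI − A + BK)⁻¹L₁·W̃ᵐ`. -/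
theorem stmt5 (n N : ℕ) (hn : 1 ≤ n) (hN : 1 ≤ N)
    (A : Matrix (Fin n) (Fin n) ℂ) (B : Matrix (Fin n) (Fin 1) ℂ)
    (C : Matrix (Fin 1) (Fin n) ℂ) (E : Matrix (Fin n) (Fin 1) ℂ)
    (AN : Matrix (Fin N) (Fin N) ℂ) (BN : Matrix (Fin N) (Fin 1) ℂ)
    (CN : Matrix (Fin 1) (Fin N) ℂ) (DN : ℂ)
    (K : Matrix (Fin 1) (Fin n) ℂ)
    (L1 : Matrix (Fin n) (Fin 1) ℂ) (L2 : Matrix (Fin N) (Fin 1) ℂ)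
    (τ : ℝ) (hτ : 0 < τ) (H : ℂ) (s : ℂ)
    (hA : IsUnit (s • (1 : Matrix (Fin n) (Fin n) ℂ) - A))
    (hAN : IsUnit (s • (1 : Matrix (Fin N) (Fin N) ℂ) - AN))
    (hABK : IsUnit (s • (1 : Matrix (Fin n) (Fin n) ℂ) - A + B * K))
    (hKB : 1 + (K * (s • (1 : Matrix (Fin n) (Fin n) ℂ) - A)⁻¹ * B) 0 0 ≠ 0)
    (G : ℂ) (hG : G = (C * (s • (1 : Matrix (Fin n) (Fin n) ℂ) - A)⁻¹ * B) 0 0)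
    (Gd : ℂ) (hGd : Gd = (C * (s • (1 : Matrix (Fin n) (Fin n) ℂ) - A)⁻¹ * E) 0 0)
    (PN : ℂ) (hPN : PN = (CN * (s • (1 : Matrix (Fin N) (Fin N) ℂ) - AN)⁻¹ * BN) 0 0 + DN)
    (Lest : ℂ)
    (hLest : Lest =
      PN * (C * (s • (1 : Matrix (Fin n) (Fin n) ℂ) - A)⁻¹ * L1) 0 0 +
        (CN * (s • (1 : Matrix (Fin N) (Fin N) ℂ) - AN)⁻¹ * L2) 0 0)
    (hden : 1 + Lest ≠ 0)
    (Fbar : ℂ) (hF : Fbar = (1 + Lest)⁻¹)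
    (Δ : ℂ) (hΔ : Δ = Complex.exp (-s * τ) - PN)
    (R D Noise U Wtm Y : ℂ)
    (hU : U = -((K * (s • (1 : Matrix (Fin n) (Fin n) ℂ) - A + B * K)⁻¹ * L1) 0 0) * Wtm
      + (1 + (K * (s • (1 : Matrix (Fin n) (Fin n) ℂ) - A)⁻¹ * B) 0 0)⁻¹ * H * R)
    (hWtm : Wtm = Fbar * (Δ * G * U + Complex.exp (-s * τ) * Gd * D + Noise))
    (hY : Y = (C * (s • (1 : Matrix (Fin n) (Fin n) ℂ) - A)⁻¹ * (U • B + D • E)) 0 0) :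
    Y = (C * (s • (1 : Matrix (Fin n) (Fin n) ℂ) - A + B * K)⁻¹ * B) 0 0 * H * R
      + Gd * D
      - (C * (s • (1 : Matrix (Fin n) (Fin n) ℂ) - A)⁻¹ * B) 0 0
          * (K * (s • (1 : Matrix (Fin n) (Fin n) ℂ) - A + B * K)⁻¹ * L1) 0 0 * Wtm := by
  set M := s • (1 : Matrix (Fin n) (Fin n) ℂ) - A
  have hG' : (C * (M + B * K)⁻¹ * B) 0 0 * (1 + (K * M⁻¹ * B) 0 0) = (C * M⁻¹ * B) 0 0 := by
    rw [Matrix.mul_assoc C M⁻¹, ← inv_add_mul_mul_one_add B K hA hABK, ← Matrix.mul_assoc C,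
      ← Matrix.mul_assoc C]
    simp [Matrix.mul_apply (M := C * (M + B * K)⁻¹ * B)]
  have hYscalar : Y = (C * M⁻¹ * B) 0 0 * U + Gd * D := by
    rw [hY, hGd, Matrix.mul_add, Matrix.mul_smul, Matrix.mul_smul]
    simp [mul_comm]
  rw [hYscalar, hU, ← hG']
  field_simp
  ring
end
end

section
/- Let z ∈ ℂ with z ≠ 0 and zI_n − A invertible, and assume 1 + z^{−M} C(zI_n − A)⁻¹L_1 + C_q(zI_M − A_q)⁻¹L_2 ≠ 0; set F(z) = (1 + z^{−M} C(zI_n − A)⁻¹L_1 + C_q(zI_M − A_q)⁻¹L_2)⁻¹. Suppose the complex scalars U, D, N, W̃ᵐ, W̃ and the vector X̂ ∈ ℂ^n satisfy: W = z^{−M} G(z) U + z^{−M} C(zI_n − A)⁻¹E · D; X̂ = (zI_n − A)⁻¹(B U + L_1 W̃ᵐ); Ŵ = C_q(zI_M − A_q)⁻¹(B_q C X̂ + L_2 W̃ᵐ); W̃ᵐ = W + N − Ŵ; and W̃ = W̃ᵐ − N. Then W̃ = F(z) · z^{−M} C(zI_n − A)⁻¹E · D + (F(z) − 1) · N. -/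
open Matrix

noncomputable section

/-- `zI - S` is invertible for `z ≠ 0`, where `S` is the lower shift matrix. -/
theorem isUnit_det_smul_one_sub_shift (M : ℕ) {z : ℂ} (hz : z ≠ 0) :
    IsUnit (z • (1 : Matrix (Fin M) (Fin M) ℂ)
      - Matrix.of fun (i j : Fin M) => if (i : ℕ) = (j : ℕ) + 1 then (1 : ℂ) else 0).det := by
  rw [Matrix.det_of_isLowerTriangular]
  · simp [hz]
  · intro i j hij
    have hlt : (i : ℕ) < j := hij
    have hne : i ≠ j := Fin.ne_of_val_ne hlt.ne
    have hne' : (i : ℕ) ≠ j + 1 := by lia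
    simp [hne, hne']

/-- The first column of the resolvent of the lower shift matrix. -/
theorem smul_one_sub_shift_mul (M : ℕ) {z : ℂ} (hz : z ≠ 0) :
    (z • (1 : Matrix (Fin M) (Fin M) ℂ)
      - Matrix.of fun (i j : Fin M) => if (i : ℕ) = (j : ℕ) + 1 then (1 : ℂ) else 0)
      * (Matrix.of fun (i : Fin M) (_ : Fin 1) => (z ^ ((i : ℕ) + 1))⁻¹)
    = Matrix.of fun (i : Fin M) (_ : Fin 1) => if (i : ℕ) = 0 then (1 : ℂ) else 0 := by
  ext i k
  rw [Matrix.sub_mul, Matrix.smul_mul, Matrix.one_mul]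
  simp only [Matrix.sub_apply, Matrix.smul_apply, Matrix.mul_apply, Matrix.of_apply, smul_eq_mul]
  obtain ⟨i, hi⟩ := i
  cases i with
  | zero => simp [hz]
  | succ m =>
    rw [Finset.sum_eq_single (⟨m, by lia⟩ : Fin M)]
    · simp only [if_true, one_mul, Nat.succ_ne_zero, if_false]
      field_simp
      ring
    · intro j _ hj
      have hne : m ≠ j := fun h => hj (Fin.ext h.symm)
      simp [hne]
    · simp

/-- The shift-register realization of the `M`-step delay has transfer function `z⁻ᴹ`. -/
theorem delay_transfer (M : ℕ) (hM : 1 ≤ M) {z : ℂ} (hz : z ≠ 0) :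
    ((Matrix.of fun (_ : Fin 1) (j : Fin M) => if (j : ℕ) = M - 1 then (1 : ℂ) else 0)
      * (z • (1 : Matrix (Fin M) (Fin M) ℂ)
        - Matrix.of fun (i j : Fin M) => if (i : ℕ) = (j : ℕ) + 1 then (1 : ℂ) else 0)⁻¹
      * Matrix.of fun (i : Fin M) (_ : Fin 1) => if (i : ℕ) = 0 then (1 : ℂ) else 0) 0 0
    = (z ^ M)⁻¹ := by
  rw [← smul_one_sub_shift_mul M hz, Matrix.mul_assoc,
    Matrix.nonsing_inv_mul_cancel_left _ _ (isUnit_det_smul_one_sub_shift M hz), Matrix.mul_apply,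
    Finset.sum_eq_single (⟨M - 1, by lia⟩ : Fin M)]
  · simp [Nat.sub_add_cancel hM]
  · intro j _ hj
    have hne : (j : ℕ) ≠ M - 1 := fun h => hj (Fin.ext h)
    simp [hne]
  · simp

/-- Corollary 2 (discrete-time tradeoff filter), pointwise in `z`: given the
defining relations for `W`, `X̂`, `Ŵ`, `W̃ᵐ` and `W̃`, the estimation error
satisfies `W̃ = F(z)·z^{−M}C(zI − A)⁻¹E·D + (F(z) − 1)·N`. -/
theorem stmt19 (n M : ℕ) (hn : 1 ≤ n) (hM : 1 ≤ M)
    (A : Matrix (Fin n) (Fin n) ℂ) (B : Matrix (Fin n) (Fin 1) ℂ)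
    (C : Matrix (Fin 1) (Fin n) ℂ) (E : Matrix (Fin n) (Fin 1) ℂ)
    (L1 : Matrix (Fin n) (Fin 1) ℂ) (L2 : Matrix (Fin M) (Fin 1) ℂ)
    (Aq : Matrix (Fin M) (Fin M) ℂ)
    (hAq : Aq = Matrix.of fun (i j : Fin M) => if (i : ℕ) = (j : ℕ) + 1 then 1 else 0)
    (Bq : Matrix (Fin M) (Fin 1) ℂ)
    (hBq : Bq = Matrix.of fun (i : Fin M) (_ : Fin 1) => if (i : ℕ) = 0 then 1 else 0)
    (Cq : Matrix (Fin 1) (Fin M) ℂ)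
    (hCq : Cq = Matrix.of fun (_ : Fin 1) (j : Fin M) => if (j : ℕ) = M - 1 then 1 else 0)
    (z : ℂ) (hz : z ≠ 0)
    (hzA : IsUnit (z • (1 : Matrix (Fin n) (Fin n) ℂ) - A))
    (Fz : ℂ)
    (hden : 1 + (z ^ M)⁻¹ * (C * (z • (1 : Matrix (Fin n) (Fin n) ℂ) - A)⁻¹ * L1) 0 0
      + (Cq * (z • (1 : Matrix (Fin M) (Fin M) ℂ) - Aq)⁻¹ * L2) 0 0 ≠ 0)
    (hFz : Fz = (1 + (z ^ M)⁻¹ * (C * (z • (1 : Matrix (Fin n) (Fin n) ℂ) - A)⁻¹ * L1) 0 0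
      + (Cq * (z • (1 : Matrix (Fin M) (Fin M) ℂ) - Aq)⁻¹ * L2) 0 0)⁻¹)
    (U D Noise Wtm Wt W What : ℂ) (Xhat : Fin n → ℂ)
    (G : ℂ) (hG : G = (C * (z • (1 : Matrix (Fin n) (Fin n) ℂ) - A)⁻¹ * B) 0 0)
    (hW : W = (z ^ M)⁻¹ * G * U
      + (z ^ M)⁻¹ * (C * (z • (1 : Matrix (Fin n) (Fin n) ℂ) - A)⁻¹ * E) 0 0 * D)
    (hXhat : Xhat = ((z • (1 : Matrix (Fin n) (Fin n) ℂ) - A)⁻¹).mulVec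
      (fun i => B i 0 * U + L1 i 0 * Wtm))
    (hWhat : What = ((Cq * (z • (1 : Matrix (Fin M) (Fin M) ℂ) - Aq)⁻¹).mulVec
      ((Bq * C).mulVec Xhat + fun i => L2 i 0 * Wtm)) 0)
    (hWtm : Wtm = W + Noise - What)
    (hWt : Wt = Wtm - Noise) :
    Wt = Fz * ((z ^ M)⁻¹ * (C * (z • (1 : Matrix (Fin n) (Fin n) ℂ) - A)⁻¹ * E) 0 0 * D)
      + (Fz - 1) * Noise := by
  have hdelay := delay_transfer M hM hz
  rw [← hAq, ← hBq, ← hCq] at hdelay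
  set R := (z • (1 : Matrix (Fin n) (Fin n) ℂ) - A)⁻¹
  set Q := (z • (1 : Matrix (Fin M) (Fin M) ℂ) - Aq)⁻¹
  have hCX : (C *ᵥ Xhat) 0 = G * U + (C * R * L1) 0 0 * Wtm := by
    have hinput : (fun i => B i 0 * U + L1 i 0 * Wtm) = U • B.col 0 + Wtm • L1.col 0 := by
      ext i
      simp [mul_comm]
    rw [hXhat, hinput, hG, Matrix.mulVec_mulVec, Matrix.mulVec_add, Matrix.mulVec_smul,
      Matrix.mulVec_smul, Pi.add_apply, Pi.smul_apply, Pi.smul_apply, smul_eq_mul, smul_eq_mul,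
      mul_comm U, mul_comm Wtm]
    rfl
  have hWhat' : What = (z ^ M)⁻¹ * (C *ᵥ Xhat) 0 + (Cq * Q * L2) 0 0 * Wtm := by
    have hinput : (fun i => L2 i 0 * Wtm) = Wtm • L2.col 0 := by
      ext i
      simp [mul_comm]
    rw [hWhat, hinput, Matrix.mulVec_add, Matrix.mulVec_smul, Matrix.mulVec_mulVec,
      ← Matrix.mul_assoc, ← Matrix.mulVec_mulVec, Pi.add_apply, Pi.smul_apply, smul_eq_mul,
      mul_comm Wtm, ← hdelay]
    congr 1
    simp [Matrix.mulVec, dotProduct]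
  rw [hCX] at hWhat'
  have hsolve : (1 + (z ^ M)⁻¹ * (C * R * L1) 0 0 + (Cq * Q * L2) 0 0) * Wtm
      = (z ^ M)⁻¹ * (C * R * E) 0 0 * D + Noise := by
    linear_combination hWtm + hW - hWhat'
  have hWtm' : Wtm = Fz * ((z ^ M)⁻¹ * (C * R * E) 0 0 * D + Noise) := by
    rw [← hsolve, hFz, inv_mul_cancel_left₀ hden]
  rw [hWt, hWtm']
  ring
end
end
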